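/- Let c > 0 be a fixed constant. Then: (i) there exists a constant t > 0 (depending only on c) such that almost surely every rigid component of the Erdős–Rényi random graph G(n, c/n) spans either 2 vertices, 3 vertices, or at least t·n vertices; and (ii) if c > 4, then almost surely G(n, c/n) contains a rigid component spanning at least n/10 vertices. -/

import Mathlib

open MeasureTheory Filter

noncomputable instance {n : ℕ} : MeasurableSpace (SimpleGraph (Fin n)) := ⊤

/-- The Bernoulli(p) measure on `Bool`. -/
noncomputable def bernoulliMeasure (p : ℝ) : Measure Bool :=
  ENNReal.ofReal p • Measure.dirac true + ENNReal.ofReal (1 - p) • Measure.dirac false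

/-- The Erdős–Rényi measure on simple graphs on `Fin n`: the pushforward to
`SimpleGraph (Fin n)` of the product Bernoulli(p) measure over unordered pairs
of distinct vertices. -/
noncomputable def erdosRenyi (n : ℕ) (p : ℝ) : Measure (SimpleGraph (Fin n)) :=
  Measure.map
    (fun f : ({e : Sym2 (Fin n) // ¬ e.IsDiag} → Bool) =>
      SimpleGraph.fromEdgeSet {e : Sym2 (Fin n) | ∃ h : ¬ e.IsDiag, f ⟨e, h⟩ = true})
    (Measure.pi fun _ => bernoulliMeasure p)

/-- The edges of `G` spanned by the vertex set `S`. -/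
def spannedEdges {n : ℕ} (G : SimpleGraph (Fin n)) (S : Finset (Fin n)) : Set (Sym2 (Fin n)) :=
  {e | e ∈ G.edgeSet ∧ ∀ v ∈ e, v ∈ S}

/-- `H` is a (2,3)-tight (Laman) graph on the vertex set `S`: all edges of `H` lie
inside `S`, every subset `T ⊆ S` with `|T| ≥ 2` spans at most `2|T| - 3` edges, and
`H` has exactly `2|S| - 3` edges. -/
def IsTightOn {n : ℕ} (H : SimpleGraph (Fin n)) (S : Finset (Fin n)) : Prop :=
  (∀ e ∈ H.edgeSet, ∀ v ∈ e, v ∈ S) ∧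
  (∀ T : Finset (Fin n), T ⊆ S → 2 ≤ T.card →
    (spannedEdges H T).ncard ≤ 2 * T.card - 3) ∧
  H.edgeSet.ncard = 2 * S.card - 3

/-- The induced subgraph `G[S]` is rigid: it contains a spanning (2,3)-tight subgraph. -/
def IsRigidOn {n : ℕ} (G : SimpleGraph (Fin n)) (S : Finset (Fin n)) : Prop :=
  ∃ H ≤ G, IsTightOn H S

/-- `S` is a rigid component of `G`: `|S| ≥ 2`, `G[S]` is rigid, and `S` is
inclusion-wise maximal with this property. -/
def IsRigidComponent {n : ℕ} (G : SimpleGraph (Fin n)) (S : Finset (Fin n)) : Prop :=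
  2 ≤ S.card ∧ IsRigidOn G S ∧
  ∀ S' : Finset (Fin n), S ⊆ S' → IsRigidOn G S' → S' = S

/-- `S` spans at least `2|S| - 3` edges of `G` and every vertex outside `S` has at most one
neighbour in `S`. -/
def IsDenseClosed {n : ℕ} (G : SimpleGraph (Fin n)) (S : Finset (Fin n)) : Prop :=
  2 * S.card - 3 ≤ (spannedEdges G S).ncard ∧
    ∀ v ∉ S, ∀ a ∈ S, ∀ b ∈ S, G.Adj v a → G.Adj v b → a = b

theorem spannedEdges_mono {n : ℕ} {G H : SimpleGraph (Fin n)} (h : G ≤ H) {S T : Finset (Fin n)}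
    (hST : S ⊆ T) : spannedEdges G S ⊆ spannedEdges H T := fun _ he =>
  ⟨SimpleGraph.edgeSet_mono h he.1, fun v hv => hST (he.2 v hv)⟩

theorem IsRigidOn.mono {n : ℕ} {G G' : SimpleGraph (Fin n)} (h : G ≤ G') {S : Finset (Fin n)}
    (hS : IsRigidOn G S) : IsRigidOn G' S := by
  obtain ⟨H, hH, hT⟩ := hS
  exact ⟨H, hH.trans h, hT⟩

theorem IsRigidOn.le_ncard_spannedEdges {n : ℕ} {G : SimpleGraph (Fin n)} {S : Finset (Fin n)}
    (hS : IsRigidOn G S) : 2 * S.card - 3 ≤ (spannedEdges G S).ncard := by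
  obtain ⟨H, hH, h1, -, h3⟩ := hS
  rw [← h3]
  exact Set.ncard_le_ncard (fun e he => ⟨SimpleGraph.edgeSet_mono hH he, h1 e he⟩)
    (Set.toFinite _)

theorem IsRigidOn.insert {n : ℕ} {G : SimpleGraph (Fin n)} {S : Finset (Fin n)}
    (hS : IsRigidOn G S) (h2 : 2 ≤ S.card) {v a b : Fin n} (hv : v ∉ S) (ha : a ∈ S) (hb : b ∈ S)
    (hab : a ≠ b) (hva : G.Adj v a) (hvb : G.Adj v b) : IsRigidOn G (insert v S) := by
  classical
  obtain ⟨H, hH, h1, h2', h3⟩ := hS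
  have hedge : (H ⊔ SimpleGraph.fromEdgeSet {s(v, a), s(v, b)}).edgeSet
      = H.edgeSet ∪ {s(v, a), s(v, b)} := by
    rw [SimpleGraph.edgeSet_sup, SimpleGraph.edgeSet_fromEdgeSet]
    congr 1
    ext e
    simp only [Set.mem_sdiff, Set.mem_insert_iff, Set.mem_singleton_iff, Sym2.mem_diagSet]
    constructor
    · exact fun h => h.1
    · rintro (rfl | rfl)
      · exact ⟨Or.inl rfl, by simpa using hva.ne⟩
      · exact ⟨Or.inr rfl, by simpa using hvb.ne⟩
  refine ⟨H ⊔ SimpleGraph.fromEdgeSet {s(v, a), s(v, b)}, ?_, ?_, ?_, ?_⟩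
  · refine sup_le hH ?_
    rw [← SimpleGraph.edgeSet_subset_edgeSet, SimpleGraph.edgeSet_fromEdgeSet]
    rintro e ⟨rfl | rfl, -⟩
    · exact hva
    · exact hvb
  · rw [hedge]
    rintro e (he | rfl | rfl) w hw
    · exact Finset.mem_insert_of_mem (h1 e he w hw)
    · rcases Sym2.mem_iff.1 hw with rfl | rfl <;> simp [*]
    · rcases Sym2.mem_iff.1 hw with rfl | rfl <;> simp [*]
  · intro T hT hT2
    by_cases hvT : v ∈ T
    · have hsub : T.erase v ⊆ S := fun x hx => by
        have := hT (Finset.mem_of_mem_erase hx)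
        exact (Finset.mem_insert.1 this).resolve_left (Finset.ne_of_mem_erase hx)
      have hcard : (T.erase v).card + 1 = T.card := Finset.card_erase_add_one hvT
      have hspan : spannedEdges (H ⊔ SimpleGraph.fromEdgeSet {s(v, a), s(v, b)}) T
          ⊆ spannedEdges H (T.erase v) ∪
            ((T.erase v ∩ {a, b}).image (fun x => s(v, x)) : Finset (Sym2 (Fin n))) := by
        rintro e ⟨he, heT⟩
        rw [hedge] at he
        rcases he with he | rfl | rfl
        · refine Or.inl ⟨he, fun w hw => Finset.mem_erase.2 ⟨?_, heT w hw⟩⟩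
          rintro rfl
          exact hv (h1 e he _ hw)
        · refine Or.inr ?_
          simp only [Finset.coe_image, Set.mem_image, Finset.mem_coe]
          refine ⟨a, ?_, rfl⟩
          simp [heT a (by simp), hva.ne']
        · refine Or.inr ?_
          simp only [Finset.coe_image, Set.mem_image, Finset.mem_coe]
          refine ⟨b, ?_, rfl⟩
          simp [heT b (by simp), hvb.ne']
      have hle := (Set.ncard_le_ncard hspan (Set.toFinite _)).trans (Set.ncard_union_le _ _)
      rw [Set.ncard_coe_finset] at hle
      have hi := Finset.card_image_le (s := T.erase v ∩ {a, b}) (f := fun x => s(v, x))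
      have hi1 := Finset.card_le_card (Finset.inter_subset_left (s₁ := T.erase v) (s₂ := {a, b}))
      have hi2 := Finset.card_le_card (Finset.inter_subset_right (s₁ := T.erase v) (s₂ := {a, b}))
      rw [Finset.card_pair hab] at hi2
      by_cases hc : 2 ≤ (T.erase v).card
      · have := h2' _ hsub hc
        omega
      · have hz : spannedEdges H (T.erase v) = ∅ := by
          rw [Set.eq_empty_iff_forall_notMem]
          rintro e ⟨he, heT⟩
          induction e using Sym2.ind with
          | _ x y =>
            have hx := heT x (by simp)
            have hy := heT y (by simp)
            exact (SimpleGraph.Adj.ne (G := H) he)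
              (Finset.card_le_one.1 (by omega : (T.erase v).card ≤ 1) x hx y hy)
        rw [hz, Set.ncard_empty] at hle
        omega
    · have hsub : T ⊆ S := fun x hx =>
        (Finset.mem_insert.1 (hT hx)).resolve_left (by rintro rfl; exact hvT hx)
      refine (Set.ncard_le_ncard ?_ (Set.toFinite _)).trans (h2' T hsub hT2)
      rintro e ⟨he, heT⟩
      rw [hedge] at he
      rcases he with he | rfl | rfl
      · exact ⟨he, heT⟩
      · exact absurd (heT v (by simp)) hvT
      · exact absurd (heT v (by simp)) hvT
  · rw [hedge, Set.ncard_union_eq ?_ (Set.toFinite _) (Set.toFinite _), h3, Set.ncard_pair,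
      Finset.card_insert_of_notMem hv]
    · omega
    · intro h
      rw [Sym2.congr_right] at h
      exact hab h
    · rw [Set.disjoint_left]
      rintro e he (rfl | rfl)
      · exact hv (h1 _ he v (by simp))
      · exact hv (h1 _ he v (by simp))

theorem IsRigidComponent.isDenseClosed {n : ℕ} {G : SimpleGraph (Fin n)} {S : Finset (Fin n)}
    (hS : IsRigidComponent G S) : IsDenseClosed G S := by
  refine ⟨hS.2.1.le_ncard_spannedEdges, fun v hv a ha b hb hva hvb => ?_⟩
  by_contra hab
  have := hS.2.2 _ (Finset.subset_insert v S) (hS.2.1.insert hS.1 hv ha hb hab hva hvb)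
  exact hv (this ▸ Finset.mem_insert_self v S)

theorem IsRigidOn.exists_isRigidComponent {n : ℕ} {G : SimpleGraph (Fin n)} {S : Finset (Fin n)}
    (hS : IsRigidOn G S) (h2 : 2 ≤ S.card) : ∃ S', S ⊆ S' ∧ IsRigidComponent G S' := by
  obtain ⟨M, hSM, hM⟩ := (Set.toFinite {S | IsRigidOn G S}).exists_le_maximal hS
  exact ⟨M, hSM, h2.trans (Finset.card_le_card hSM), hM.1,
    fun S' h h' => (hM.2 h' h).antisymm h⟩

theorem exists_isRigidOn_of_le_ncard {n : ℕ} (hn : 2 ≤ n) {G : SimpleGraph (Fin n)}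
    (h : 2 * n - 2 ≤ (spannedEdges G Finset.univ).ncard) :
    ∃ S : Finset (Fin n), 4 ≤ S.card ∧ IsRigidOn G S := by
  classical
  obtain ⟨S, -, hS⟩ := (Set.toFinite {S : Finset (Fin n) | 2 ≤ S.card ∧
    2 * S.card - 2 ≤ (spannedEdges G S).ncard}).exists_le_minimal
      (a := Finset.univ) ⟨by simpa using hn, by simpa using h⟩
  obtain ⟨hS2, hSe⟩ : 2 ≤ S.card ∧ 2 * S.card - 2 ≤ (spannedEdges G S).ncard := hS.1
  refine ⟨S, ?_, ?_⟩
  · have hsub : spannedEdges G S ⊆ (S.offDiag.image (Function.uncurry Sym2.mk) : Finset _) := by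
      rintro e ⟨he, heS⟩
      induction e using Sym2.ind with
      | _ x y =>
        simp only [Finset.coe_image, Set.mem_image, Finset.mem_coe, Finset.mem_offDiag]
        exact ⟨(x, y), ⟨heS x (by simp), heS y (by simp), SimpleGraph.Adj.ne (G := G) he⟩, rfl⟩
    have hle := Set.ncard_le_ncard hsub (Set.toFinite _)
    rw [Set.ncard_coe_finset, Sym2.card_image_offDiag] at hle
    by_contra hlt
    have : S.card = 2 ∨ S.card = 3 := by omega
    have h2 : Nat.choose 2 2 = 1 := rfl
    have h3 : Nat.choose 3 2 = 3 := rfl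
    rcases this with h | h <;> rw [h] at hle hSe <;> omega
  · have hle : 2 * S.card - 3 ≤ (spannedEdges G S).ncard := by omega
    obtain ⟨F, hFsub, hF⟩ := Set.exists_subset_card_eq hle
    have hFe : (SimpleGraph.fromEdgeSet F).edgeSet = F := by
      rw [SimpleGraph.edgeSet_fromEdgeSet]
      refine sdiff_eq_left.2 (Set.disjoint_left.2 fun e he hd => ?_)
      exact SimpleGraph.not_isDiag_of_mem_edgeSet G (hFsub he).1 hd
    have hFG : SimpleGraph.fromEdgeSet F ≤ G := by
      rw [← SimpleGraph.edgeSet_subset_edgeSet, hFe]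
      exact fun e he => (hFsub he).1
    refine ⟨SimpleGraph.fromEdgeSet F, hFG, ?_, ?_, by rw [hFe, hF]⟩
    · rw [hFe]
      exact fun e he => (hFsub he).2
    · intro T hT hT2
      by_cases hTS : T = S
      · subst hTS
        rw [← hF]
        refine Set.ncard_le_ncard (fun e he => ?_) (Set.toFinite _)
        rw [← hFe]
        exact he.1
      · by_contra hcon
        refine hTS (hT.antisymm (hS.2 (y := T) ⟨hT2, ?_⟩ hT))
        have := Set.ncard_le_ncard (spannedEdges_mono hFG (Finset.Subset.refl T))
          (Set.toFinite _)
        omega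

/-- The potential edges of a graph on `Fin n`. -/
abbrev VertexPair (n : ℕ) : Type := {e : Sym2 (Fin n) // ¬ e.IsDiag}

/-- The graph whose edges are the pairs marked `true`. -/
def graphOfMarks {n : ℕ} (f : VertexPair n → Bool) : SimpleGraph (Fin n) :=
  SimpleGraph.fromEdgeSet {e : Sym2 (Fin n) | ∃ h : ¬ e.IsDiag, f ⟨e, h⟩ = true}

theorem graphOfMarks_adj {n : ℕ} {f : VertexPair n → Bool} {a b : Fin n} (hab : a ≠ b) :
    (graphOfMarks f).Adj a b ↔ f ⟨s(a, b), by simpa using hab⟩ = true := by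
  simp [graphOfMarks, hab]

theorem graphOfMarks_mono {n : ℕ} {f g : VertexPair n → Bool} (h : f ≤ g) :
    graphOfMarks f ≤ graphOfMarks g := by
  refine SimpleGraph.fromEdgeSet_mono ?_
  rintro e ⟨he, hfe⟩
  exact ⟨he, Bool.eq_true_of_true_le (hfe ▸ h ⟨e, he⟩)⟩

open Classical in
/-- The potential edges with both endpoints in `S`. -/
noncomputable def pairsIn {n : ℕ} (S : Finset (Fin n)) : Finset (VertexPair n) :=
  Finset.univ.filter fun e => ∀ v ∈ e.1, v ∈ S

theorem card_pairsIn {n : ℕ} (S : Finset (Fin n)) : (pairsIn S).card = S.card.choose 2 := by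
  classical
  rw [← Sym2.card_image_offDiag, ← Finset.card_map (Function.Embedding.subtype _)]
  congr 1
  ext e
  induction e using Sym2.ind with
  | _ x y =>
    simp only [pairsIn, Finset.mem_map, Finset.mem_filter, Finset.mem_univ, true_and,
      Function.Embedding.subtype_apply, Subtype.exists, Finset.mem_image, Finset.mem_offDiag,
      Prod.exists, Function.uncurry_apply_pair]
    constructor
    · rintro ⟨e, he, h, rfl⟩
      exact ⟨x, y, ⟨h x (by simp), h y (by simp), by simpa using he⟩, rfl⟩
    · rintro ⟨a, b, ⟨ha, hb, hab⟩, h⟩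
      refine ⟨s(a, b), by simpa using hab, ?_, h⟩
      intro v hv
      rcases Sym2.mem_iff.1 hv with rfl | rfl <;> assumption

theorem ncard_spannedEdges_graphOfMarks {n : ℕ} (f : VertexPair n → Bool) (S : Finset (Fin n)) :
    (spannedEdges (graphOfMarks f) S).ncard = ((pairsIn S).filter fun e => f e = true).card := by
  classical
  rw [← Finset.card_map (Function.Embedding.subtype _), ← Set.ncard_coe_finset]
  congr 1
  ext e
  simp only [spannedEdges, graphOfMarks, SimpleGraph.edgeSet_fromEdgeSet, Set.mem_ofPred_eq,
    Set.mem_sdiff, Sym2.mem_diagSet, Finset.coe_map, Set.mem_image, Finset.mem_coe,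
    Finset.mem_filter, pairsIn, Finset.mem_univ, true_and, Function.Embedding.subtype_apply,
    Subtype.exists]
  constructor
  · rintro ⟨⟨⟨h, hf⟩, -⟩, hS⟩
    exact ⟨e, h, ⟨hS, hf⟩, rfl⟩
  · rintro ⟨e, h, ⟨hS, hf⟩, rfl⟩
    exact ⟨⟨⟨h, hf⟩, h⟩, hS⟩

theorem isProbabilityMeasure_bernoulliMeasure {p : ℝ} (h0 : 0 ≤ p) (h1 : p ≤ 1) :
    IsProbabilityMeasure (bernoulliMeasure p) := by
  constructor
  simp only [bernoulliMeasure, Measure.coe_add, Measure.coe_smul, Pi.add_apply, Pi.smul_apply,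
    measure_univ, smul_eq_mul, mul_one]
  rw [← ENNReal.ofReal_add h0 (by linarith)]
  simp

theorem integral_bernoulliMeasure {p : ℝ} (h0 : 0 ≤ p) (h1 : p ≤ 1) (g : Bool → ℝ) :
    ∫ b, g b ∂bernoulliMeasure p = p * g true + (1 - p) * g false := by
  have := isProbabilityMeasure_bernoulliMeasure h0 h1
  rw [integral_fintype (Integrable.of_finite), Fintype.sum_bool]
  simp [bernoulliMeasure, Measure.real, h0, sub_nonneg.2 h1]

/-- If `∑ₖ ∏ᵢ gₖᵢ(fᵢ) ≥ a` on the event `A`, then `a * P(A) ≤ ∑ₖ ∏ᵢ E[gₖᵢ(fᵢ)]`. -/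
theorem mul_measureReal_pi_bernoulliMeasure_le {ι κ : Type*} [Fintype ι] {p a : ℝ} (h0 : 0 ≤ p)
    (h1 : p ≤ 1) {A : Set (ι → Bool)} (s : Finset κ) (g : κ → ι → Bool → ℝ)
    (hg : ∀ k i b, 0 ≤ g k i b) (hA : ∀ f ∈ A, a ≤ ∑ k ∈ s, ∏ i, g k i (f i)) :
    a * (Measure.pi fun _ : ι => bernoulliMeasure p).real A
      ≤ ∑ k ∈ s, ∏ i, (p * g k i true + (1 - p) * g k i false) := by
  classical
  have := isProbabilityMeasure_bernoulliMeasure h0 h1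
  have hint : ∫ f, ∑ k ∈ s, ∏ i, g k i (f i) ∂(Measure.pi fun _ : ι => bernoulliMeasure p)
      = ∑ k ∈ s, ∏ i, (p * g k i true + (1 - p) * g k i false) := by
    rw [integral_finsetSum _ fun _ _ => Integrable.of_finite]
    refine Finset.sum_congr rfl fun k _ => ?_
    rw [integral_fintype_prod_eq_prod]
    exact Finset.prod_congr rfl fun i _ => integral_bernoulliMeasure h0 h1 _
  rw [← hint, mul_comm, ← smul_eq_mul, ← integral_indicator_const a (Set.toFinite A).measurableSet]
  refine integral_mono Integrable.of_finite Integrable.of_finite fun f => ?_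
  by_cases hf : f ∈ A
  · simpa [hf] using hA f hf
  · simpa [hf] using Finset.sum_nonneg fun k _ => Finset.prod_nonneg fun i _ => hg k i _

theorem erdosRenyi_apply {n : ℕ} (p : ℝ) (A : Set (SimpleGraph (Fin n))) :
    erdosRenyi n p A
      = (Measure.pi fun _ : VertexPair n => bernoulliMeasure p) (graphOfMarks ⁻¹' A) :=
  Measure.map_apply (measurable_of_finite _) trivial

theorem measureReal_erdosRenyi {n : ℕ} (p : ℝ) (A : Set (SimpleGraph (Fin n))) :
    (erdosRenyi n p).real A
      = (Measure.pi fun _ : VertexPair n => bernoulliMeasure p).real (graphOfMarks ⁻¹' A) := by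
  rw [Measure.real, erdosRenyi_apply, Measure.real]

theorem isProbabilityMeasure_erdosRenyi (n : ℕ) {p : ℝ} (h0 : 0 ≤ p) (h1 : p ≤ 1) :
    IsProbabilityMeasure (erdosRenyi n p) := by
  have := isProbabilityMeasure_bernoulliMeasure h0 h1
  exact ⟨by rw [erdosRenyi_apply]; simp⟩

theorem measurable_decide_le (r : ℝ) : Measurable fun u : ℝ => decide (u ≤ r) := by
  refine measurable_to_bool ?_
  convert measurableSet_Iic (a := r) using 1
  ext
  simp

theorem bernoulliMeasure_eq_map {p : ℝ} (h0 : 0 ≤ p) (h1 : p ≤ 1) :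
    bernoulliMeasure p
      = (volume.restrict (Set.Icc (0 : ℝ) 1)).map fun u => decide (u ≤ p) := by
  have hm : Measurable fun u : ℝ => decide (u ≤ p) := measurable_decide_le p
  have ht : (fun u : ℝ => decide (u ≤ p)) ⁻¹' {true} = Set.Iic p := by ext; simp
  have hf : (fun u : ℝ => decide (u ≤ p)) ⁻¹' {false} = Set.Ioi p := by ext; simp
  have hT : Set.Iic p ∩ Set.Icc 0 1 = Set.Icc 0 p := by
    ext u; simp only [Set.mem_inter_iff, Set.mem_Iic, Set.mem_Icc]; constructor <;> grind
  have hF : Set.Ioi p ∩ Set.Icc 0 1 = Set.Ioc p 1 := by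
    ext u; simp only [Set.mem_inter_iff, Set.mem_Ioi, Set.mem_Icc, Set.mem_Ioc]
    constructor <;> grind
  refine Measure.ext_of_singleton fun b => ?_
  rw [Measure.map_apply hm (MeasurableSet.singleton b)]
  cases b
  · rw [hf, Measure.restrict_apply measurableSet_Ioi, hF]
    simp [bernoulliMeasure]
  · rw [ht, Measure.restrict_apply measurableSet_Iic, hT]
    simp [bernoulliMeasure]

theorem erdosRenyi_mono {n : ℕ} {p q : ℝ} (h0 : 0 ≤ p) (hpq : p ≤ q) (h1 : q ≤ 1)
    {A : Set (SimpleGraph (Fin n))} (hA : ∀ G ∈ A, ∀ H, G ≤ H → H ∈ A) :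
    erdosRenyi n p A ≤ erdosRenyi n q A := by
  have hm : ∀ r : ℝ, Measurable fun (u : VertexPair n → ℝ) e => decide (u e ≤ r) := fun r =>
    measurable_pi_lambda _ fun e => (measurable_decide_le r).comp (measurable_pi_apply e)
  have key : ∀ r : ℝ, 0 ≤ r → r ≤ 1 → (Measure.pi fun _ : VertexPair n => bernoulliMeasure r)
      = (Measure.pi fun _ : VertexPair n => volume.restrict (Set.Icc (0 : ℝ) 1)).map
        fun u e => decide (u e ≤ r) := by
    intro r hr0 hr1
    have := isProbabilityMeasure_bernoulliMeasure hr0 hr1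
    rw [bernoulliMeasure_eq_map hr0 hr1] at this ⊢
    rw [Measure.pi_map_pi fun _ => (measurable_decide_le r).aemeasurable]
  rw [erdosRenyi_apply, erdosRenyi_apply, key p h0 (hpq.trans h1), key q (h0.trans hpq) h1,
    Measure.map_apply (hm p) (Set.toFinite _).measurableSet,
    Measure.map_apply (hm q) (Set.toFinite _).measurableSet]
  refine measure_mono fun u hu => hA _ hu _ (graphOfMarks_mono fun e => ?_)
  by_cases h : u e ≤ p
  · simp [h, h.trans hpq]
  · simp [h]

theorem prod_vertexPair_eq {n : ℕ} (S : Finset (Fin n)) (h : VertexPair n → ℝ)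
    (h' : Fin n → Fin n → ℝ) (hout : ∀ e : VertexPair n, (∀ v ∈ e.1, v ∉ S) → h e = 1)
    (hcross : ∀ v ∉ S, ∀ s ∈ S, ∀ e : VertexPair n, e.1 = s(v, s) → h e = h' v s) :
    ∏ e, h e = (∏ e ∈ pairsIn S, h e) * ∏ v ∈ Sᶜ, ∏ s ∈ S, h' v s := by
  classical
  set C : Finset (VertexPair n) :=
    Finset.univ.filter fun e => ∃ v ∉ S, ∃ s ∈ S, e.1 = s(v, s) with hC
  have hdisj : Disjoint (pairsIn S) C := by
    rw [Finset.disjoint_left]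
    intro e he hc
    simp only [pairsIn, hC, Finset.mem_filter, Finset.mem_univ, true_and] at he hc
    obtain ⟨v, hv, s, -, hvs⟩ := hc
    exact hv (he v (by simp [hvs]))
  have hrest : ∀ e ∈ Finset.univ, e ∉ pairsIn S ∪ C → h e = 1 := by
    intro e _ he
    refine hout e fun v hv hvS => he ?_
    obtain ⟨w, hw⟩ := Sym2.mem_iff_exists.1 hv
    rw [Finset.mem_union]
    by_cases hwS : w ∈ S
    · left
      simp only [pairsIn, Finset.mem_filter, Finset.mem_univ, true_and, hw]
      intro x hx
      rcases Sym2.mem_iff.1 hx with rfl | rfl <;> assumption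
    · right
      simp only [hC, Finset.mem_filter, Finset.mem_univ, true_and]
      exact ⟨w, hwS, v, hvS, hw.trans Sym2.eq_swap⟩
  rw [← Finset.prod_subset (Finset.subset_univ _) hrest, Finset.prod_union hdisj]
  congr 1
  rw [← Finset.prod_product' Sᶜ S h']
  symm
  refine Finset.prod_bij (fun p hp => ⟨s(p.1, p.2), ?_⟩) ?_ ?_ ?_ ?_
  · rw [Finset.mem_product, Finset.mem_compl] at hp
    rw [Sym2.mk_isDiag_iff]
    rintro h
    exact hp.1 (h ▸ hp.2)
  · intro p hp
    rw [Finset.mem_product, Finset.mem_compl] at hp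
    simp only [hC, Finset.mem_filter, Finset.mem_univ, true_and]
    exact ⟨p.1, hp.1, p.2, hp.2, rfl⟩
  · rintro ⟨v, s⟩ hp ⟨w, t⟩ hq hpq
    simp only [Finset.mem_product, Finset.mem_compl] at hp hq
    simp only [Subtype.mk.injEq, Sym2.eq_iff] at hpq
    rcases hpq with ⟨rfl, rfl⟩ | ⟨rfl, rfl⟩
    · rfl
    · exact absurd hp.2 hq.1
  · intro e he
    simp only [hC, Finset.mem_filter, Finset.mem_univ, true_and] at he
    obtain ⟨v, hv, s, hs, hvs⟩ := he
    exact ⟨(v, s), by simp [hv, hs], Subtype.ext hvs.symm⟩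
  · intro p hp
    rw [Finset.mem_product, Finset.mem_compl] at hp
    exact (hcross _ hp.1 _ hp.2 _ rfl).symm

/-- First-moment bound, with a free parameter `z`, for a fixed vertex set `S`. -/
theorem pow_mul_measureReal_isDenseClosed_le {n : ℕ} {p z : ℝ} (h0 : 0 ≤ p) (h1 : p ≤ 1)
    (hz : 1 ≤ z) (S : Finset (Fin n)) :
    z ^ (2 * S.card - 3) * (erdosRenyi n p).real {G | IsDenseClosed G S}
      ≤ (p * z + (1 - p)) ^ S.card.choose 2 *
        ((1 - p) ^ S.card + S.card * (p * (1 - p) ^ (S.card - 1))) ^ (n - S.card) := by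
  classical
  rw [measureReal_erdosRenyi]
  set t : Fin n → Finset (Option (Fin n)) := fun v => if v ∈ S then {none} else S.insertNone
    with ht
  set g : (Fin n → Option (Fin n)) → VertexPair n → Bool → ℝ := fun φ e b =>
    if e ∈ pairsIn S then (if b = true then z else 1) else
      if ∃ v ∉ S, ∃ s ∈ S, e.1 = s(v, s) then
        (if b = true ↔ ∃ v ∉ S, ∃ s ∈ S, e.1 = s(v, s) ∧ φ v = some s then 1 else 0)
      else 1 with hgdef
  have hgout : ∀ φ (e : VertexPair n) b, (∀ v ∈ e.1, v ∉ S) → g φ e b = 1 := by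
    intro φ e b he
    have hi : e ∉ pairsIn S := by
      simp only [pairsIn, Finset.mem_filter, Finset.mem_univ, true_and]
      intro h
      have := Sym2.out_fst_mem e.1
      exact he _ this (h _ this)
    have hc : ¬ ∃ v ∉ S, ∃ s ∈ S, e.1 = s(v, s) := by
      rintro ⟨v, -, s, hs, hvs⟩
      exact he s (by simp [hvs]) hs
    simp only [hgdef, if_neg hi, if_neg hc]
  have hgcross : ∀ φ, ∀ v ∉ S, ∀ s ∈ S, ∀ (e : VertexPair n) b, e.1 = s(v, s) →
      g φ e b = if (b = true ↔ φ v = some s) then 1 else 0 := by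
    intro φ v hv s hs e b he
    have hi : e ∉ pairsIn S := by
      simp only [pairsIn, Finset.mem_filter, Finset.mem_univ, true_and]
      intro h
      exact hv (h v (by simp [he]))
    have hc : ∃ v ∉ S, ∃ s ∈ S, e.1 = s(v, s) := ⟨v, hv, s, hs, he⟩
    have hiff : (∃ v ∉ S, ∃ s ∈ S, e.1 = s(v, s) ∧ φ v = some s) ↔ φ v = some s := by
      constructor
      · rintro ⟨w, hw, r, hr, hwr, hφ⟩
        rw [he, Sym2.eq_iff] at hwr
        rcases hwr with ⟨rfl, rfl⟩ | ⟨rfl, rfl⟩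
        · exact hφ
        · exact absurd hr hv
      · intro h
        exact ⟨v, hv, s, hs, he, h⟩
    simp only [hgdef, if_neg hi, if_pos hc, hiff]
  have hgin : ∀ φ, ∀ e ∈ pairsIn S, ∀ b, g φ e b = if b = true then z else 1 := by
    intro φ e he b
    simp only [hgdef, if_pos he]
  have hg0 : ∀ φ e b, 0 ≤ g φ e b := by
    intro φ e b
    simp only [hgdef]
    split_ifs <;> linarith
  refine (mul_measureReal_pi_bernoulliMeasure_le h0 h1 (Fintype.piFinset t) g hg0
    fun f hf => ?_).trans_eq ?_
  · obtain ⟨hdense, hclosed⟩ : IsDenseClosed (graphOfMarks f) S := hf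
    set φ : Fin n → Option (Fin n) := fun v =>
      if h : v ∉ S ∧ ∃ s ∈ S, (graphOfMarks f).Adj v s then some h.2.choose else none with hφ
    have hφt : φ ∈ Fintype.piFinset t := by
      rw [Fintype.mem_piFinset]
      intro v
      by_cases h : v ∉ S ∧ ∃ s ∈ S, (graphOfMarks f).Adj v s
      · simp only [hφ, dif_pos h, ht, if_neg h.1, Finset.some_mem_insertNone]
        exact h.2.choose_spec.1
      · simp only [hφ, dif_neg h, ht]
        split_ifs <;> simp
    refine le_trans ?_ (Finset.single_le_sum
      (fun ψ _ => Finset.prod_nonneg fun e _ => hg0 ψ e (f e)) hφt)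
    rw [prod_vertexPair_eq S (fun e => g φ e (f e)) (fun _ _ => 1)
      (fun e he => hgout _ _ _ he)]
    · simp only [Finset.prod_const_one, mul_one]
      rw [Finset.prod_congr rfl fun e he => hgin φ e he (f e), Finset.prod_ite,
        Finset.prod_const_one, mul_one, Finset.prod_const]
      refine pow_le_pow_right₀ hz ?_
      rw [← ncard_spannedEdges_graphOfMarks]
      exact hdense
    · intro v hv s hs e he
      rw [hgcross φ v hv s hs e _ he, if_pos]
      have hvs : v ≠ s := by
        rintro rfl
        exact hv hs
      have hadj : f e = true ↔ (graphOfMarks f).Adj v s := by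
        rw [graphOfMarks_adj hvs]
        have : e = ⟨s(v, s), by simpa using hvs⟩ := Subtype.ext he
        rw [this]
      rw [hadj]
      constructor
      · intro h
        have h' : v ∉ S ∧ ∃ s ∈ S, (graphOfMarks f).Adj v s := ⟨hv, s, hs, h⟩
        simp only [hφ, dif_pos h', Option.some.injEq]
        exact hclosed v hv _ h'.2.choose_spec.1 s hs h'.2.choose_spec.2 h
      · intro h
        by_cases h' : v ∉ S ∧ ∃ s ∈ S, (graphOfMarks f).Adj v s
        · simp only [hφ, dif_pos h', Option.some.injEq] at h
          rw [← h]
          exact h'.2.choose_spec.2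
        · simp [hφ, dif_neg h'] at h
  · have hprod : ∀ φ ∈ Fintype.piFinset t, ∏ e, (p * g φ e true + (1 - p) * g φ e false)
        = (p * z + (1 - p)) ^ S.card.choose 2 *
          ∏ v, if v ∈ S then 1 else ∏ s ∈ S, if φ v = some s then p else 1 - p := by
      intro φ _
      rw [prod_vertexPair_eq S _ (fun v s => if φ v = some s then p else 1 - p)
        (fun e he => by simp [hgout φ e _ he])]
      · congr 1
        · rw [Finset.prod_congr rfl fun e he => by rw [hgin φ e he, hgin φ e he],
            Finset.prod_const, card_pairsIn]
          simp
        · rw [Finset.prod_ite, Finset.prod_const_one, one_mul]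
          refine Finset.prod_congr ?_ fun _ _ => rfl
          ext v
          simp
      · intro v hv s hs e he
        rw [hgcross φ v hv s hs e _ he, hgcross φ v hv s hs e _ he]
        by_cases h : φ v = some s <;> simp [h]
    rw [Finset.sum_congr rfl hprod, ← Finset.mul_sum,
      ← Finset.prod_univ_sum t
        (fun v o => if v ∈ S then 1 else ∏ s ∈ S, if o = some s then p else 1 - p)]
    congr 1
    have hsum : ∀ v, (∑ o ∈ t v, if v ∈ S then 1 else ∏ s ∈ S, if o = some s then p else 1 - p)
        = if v ∈ S then 1 else
          (1 - p) ^ S.card + S.card * (p * (1 - p) ^ (S.card - 1)) := by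
      intro v
      by_cases hv : v ∈ S
      · simp [ht, hv]
      · simp only [ht, hv, if_false, Finset.sum_insertNone]
        congr 1
        · simp
        · rw [← nsmul_eq_mul, ← Finset.sum_const]
          refine Finset.sum_congr rfl fun r hr => ?_
          rw [← Finset.mul_prod_erase S _ hr, if_pos rfl,
            Finset.prod_congr rfl (g := fun _ => 1 - p), Finset.prod_const,
            Finset.card_erase_of_mem hr]
          intro s hs
          rw [if_neg]
          simpa using (Finset.ne_of_mem_erase hs).symm
    rw [Finset.prod_congr rfl fun v _ => hsum v, Finset.prod_ite, Finset.prod_const_one, one_mul,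
      Finset.prod_const]
    congr 1
    rw [Finset.filter_not, Finset.card_sdiff_of_subset (Finset.filter_subset _ _)]
    simp

/-- First-moment bound for a fixed vertex set `S`, after optimising the Chernoff parameter. -/
theorem measureReal_isDenseClosed_le {n k : ℕ} {p y : ℝ} (h0 : 0 < p) (h1 : p ≤ 1)
    (hk : 4 ≤ k) (hy : y = p * (k - 1)) (hym : k * y / 2 ≤ 2 * k - 3) (S : Finset (Fin n))
    (hS : S.card = k) :
    (erdosRenyi n p).real {G | IsDenseClosed G S}
      ≤ (Real.exp 1 * (k * y / 2) / (2 * k - 3)) ^ (2 * k - 3) * Real.exp (-(k * y / 2)) *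
        ((1 + y) * Real.exp (-y)) ^ (n - k) := by
  have hk' : (4 : ℝ) ≤ k := by exact_mod_cast hk
  have hy0 : 0 < y := by rw [hy]; exact mul_pos h0 (by linarith)
  set M : ℝ := k * y / 2 with hM
  have hM0 : 0 < M := by positivity
  have hm0 : (0 : ℝ) < 2 * k - 3 := by linarith
  have hcast : ((2 * k - 3 : ℕ) : ℝ) = 2 * k - 3 := by
    rw [Nat.cast_sub (by omega)]; push_cast; ring
  have hchoose : (k.choose 2 : ℝ) * p = M := by
    rw [Nat.cast_choose_two, hM, hy]; ring
  have hz : 1 ≤ (2 * k - 3) / M := by rwa [one_le_div hM0]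
  have key := pow_mul_measureReal_isDenseClosed_le h0.le h1 hz S
  rw [hS] at key
  set z : ℝ := (2 * k - 3) / M with hzdef
  have hz0 : 0 < z := by linarith
  have hA : (p * z + (1 - p)) ^ k.choose 2 ≤ Real.exp (2 * k - 3) * Real.exp (-M) := by
    have h2 : p * z + (1 - p) ≤ Real.exp (p * (z - 1)) := by
      have := Real.add_one_le_exp (p * (z - 1)); linarith
    have h3 : 0 ≤ p * z + (1 - p) := by nlinarith
    refine (pow_le_pow_left₀ h3 h2 _).trans_eq ?_
    rw [← Real.exp_nat_mul, ← Real.exp_add]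
    congr 1
    rw [← mul_assoc, hchoose, hzdef, mul_sub, mul_div_cancel₀ _ hM0.ne']
    ring
  have hQ0 : 0 ≤ (1 - p) ^ k + k * (p * (1 - p) ^ (k - 1)) := by
    have : 0 ≤ 1 - p := by linarith
    positivity
  have hQ : (1 - p) ^ k + k * (p * (1 - p) ^ (k - 1)) ≤ (1 + y) * Real.exp (-y) := by
    obtain ⟨j, rfl⟩ : ∃ j, k = j + 1 := ⟨k - 1, by omega⟩
    have hyj : y = j * p := by rw [hy]; push_cast; ring
    have h2 : (1 - p) ^ j ≤ Real.exp (-y) := by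
      have h3 : 1 - p ≤ Real.exp (-p) := by have := Real.add_one_le_exp (-p); linarith
      refine (pow_le_pow_left₀ (by linarith) h3 _).trans_eq ?_
      rw [← Real.exp_nat_mul, hyj]
      congr 1; ring
    have h4 : (1 - p) ^ (j + 1) + (j + 1 : ℕ) * (p * (1 - p) ^ (j + 1 - 1))
        = (1 + y) * (1 - p) ^ j := by
      rw [hyj, Nat.add_sub_cancel]; push_cast; ring
    rw [h4]
    exact mul_le_mul_of_nonneg_left h2 (by linarith)
  have hB := key.trans (mul_le_mul hA (pow_le_pow_left₀ hQ0 hQ (n - k)) (by positivity)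
    (by positivity))
  rw [← le_div_iff₀' (pow_pos hz0 _)] at hB
  refine hB.trans_eq ?_
  have he : Real.exp (2 * k - 3) = Real.exp 1 ^ (2 * k - 3) := by
    rw [← Real.exp_nat_mul, hcast, mul_one]
  rw [he, mul_div_assoc (Real.exp 1) M, mul_pow, hzdef, ← inv_div M, inv_pow, div_inv_eq_mul]
  ring

theorem measureReal_exists_isDenseClosed_le {n : ℕ} {p : ℝ} (K : Finset ℕ) (b : ℕ → ℝ)
    (hb0 : ∀ k ∈ K, 0 ≤ b k) (hb : ∀ k ∈ K, ∀ S : Finset (Fin n), S.card = k →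
      n.choose k * (erdosRenyi n p).real {G | IsDenseClosed G S} ≤ b k) :
    (erdosRenyi n p).real {G | ∃ S : Finset (Fin n), S.card ∈ K ∧ IsDenseClosed G S}
      ≤ ∑ k ∈ K, b k := by
  have hset : {G | ∃ S : Finset (Fin n), S.card ∈ K ∧ IsDenseClosed G S}
      = ⋃ k ∈ K, ⋃ S ∈ Finset.powersetCard k (Finset.univ : Finset (Fin n)),
        {G | IsDenseClosed G S} := by
    ext G
    simp
  rw [hset]
  refine (measureReal_biUnion_finset_le _ _).trans (Finset.sum_le_sum fun k hk => ?_)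
  refine (measureReal_biUnion_finset_le _ _).trans ?_
  rcases Nat.eq_zero_or_pos (n.choose k) with h | h
  · have hempty : Finset.powersetCard k (Finset.univ : Finset (Fin n)) = ∅ := by
      rw [← Finset.card_eq_zero, Finset.card_powersetCard, Finset.card_univ, Fintype.card_fin, h]
    rw [hempty, Finset.sum_empty]
    exact hb0 k hk
  have h' : (0 : ℝ) < n.choose k := by exact_mod_cast h
  refine (Finset.sum_le_card_nsmul _ _ (b k / n.choose k) fun S hS => ?_).trans_eq ?_
  · rw [le_div_iff₀' h']
    exact hb k hk S (Finset.mem_powersetCard.1 hS).2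
  · rw [Finset.card_powersetCard, Finset.card_univ, Fintype.card_fin, nsmul_eq_mul,
      mul_div_cancel₀ _ h'.ne']

theorem choose_le_exp_mul_div_pow (n : ℕ) {k : ℕ} (hk : 0 < k) :
    (n.choose k : ℝ) ≤ (Real.exp 1 * (n / k)) ^ k := by
  refine (Nat.choose_le_pow_div k n).trans ?_
  have h := Real.pow_div_factorial_le_exp (k : ℝ) k.cast_nonneg k
  have hk' : (0 : ℝ) < k := by exact_mod_cast hk
  have hf : (0 : ℝ) < k.factorial := by exact_mod_cast k.factorial_pos
  rw [mul_pow, div_pow, ← Real.exp_nat_mul, mul_one]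
  rw [div_le_iff₀ hf] at h
  rw [← mul_div_assoc, div_le_div_iff₀ hf (by positivity)]
  nlinarith [pow_nonneg (Nat.cast_nonneg (α := ℝ) n) k]

theorem one_add_mul_exp_neg_le {y : ℝ} (h0 : 0 ≤ y) (h1 : y ≤ 1) :
    (1 + y) * Real.exp (-y) ≤ Real.exp (-(y ^ 2 / 2 - y ^ 3 / 3)) := by
  have hu : 0 ≤ y - y ^ 2 / 2 + y ^ 3 / 3 := by nlinarith [pow_nonneg h0 3]
  have h := Real.sum_le_exp_of_nonneg hu 4
  simp only [Finset.sum_range_succ, Finset.sum_range_zero, Nat.factorial] at h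
  norm_num at h
  have h2 : 1 + y ≤ Real.exp (y - y ^ 2 / 2 + y ^ 3 / 3) := by
    refine le_trans ?_ h
    nlinarith [pow_nonneg h0 4, pow_nonneg h0 5, pow_nonneg h0 6, pow_nonneg h0 7,
      pow_nonneg h0 8, pow_nonneg h0 9, mul_nonneg (pow_nonneg h0 4) (sub_nonneg.2 h1),
      mul_nonneg (pow_nonneg h0 5) (sub_nonneg.2 h1),
      mul_nonneg (pow_nonneg h0 6) (sub_nonneg.2 h1),
      mul_nonneg (pow_nonneg h0 7) (sub_nonneg.2 h1),
      mul_nonneg (pow_nonneg h0 8) (sub_nonneg.2 h1)]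
  calc (1 + y) * Real.exp (-y)
      ≤ Real.exp (y - y ^ 2 / 2 + y ^ 3 / 3) * Real.exp (-y) := by gcongr
    _ = _ := by rw [← Real.exp_add]; congr 1; ring

theorem log_ten_gt : 23 / 10 ≤ Real.log 10 := by
  have h : (23 : ℝ) ≤ Real.log (10 ^ 10) := by
    rw [Real.le_log_iff_exp_le (by positivity), show (23 : ℝ) = (23 : ℕ) * 1 by norm_num,
      Real.exp_nat_mul]
    refine (pow_le_pow_left₀ (Real.exp_pos 1).le Real.exp_one_lt_d9.le 23).trans ?_
    norm_num
  rw [Real.log_pow] at h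
  push_cast at h
  linarith

theorem choose_mul_measureReal_le_of_small {n k : ℕ} {c : ℝ} (hc : 0 < c) (hcn : c ≤ n)
    (hk : 4 ≤ k) (hkc : c * (k / n) ≤ 1) {γ : ℝ} (hγ : γ = Real.exp 1 * (Real.exp 1 * c / 2) ^ 2)
    (hkγ : γ * (k / n) ≤ 1 / 2) (S : Finset (Fin n)) (hS : S.card = k) :
    n.choose k * (erdosRenyi n (c / n)).real {G | IsDenseClosed G S}
      ≤ (Real.exp 1 * (Real.exp 1 * c / 2)) ^ 3 * γ / n * (16 * (k * (1 / 2) ^ k)) := by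
  have hn : (0 : ℝ) < n := hc.trans_le hcn
  have hk' : (4 : ℝ) ≤ k := by exact_mod_cast hk
  set x : ℝ := k / n with hx
  set β : ℝ := Real.exp 1 * c / 2 with hβ
  set y : ℝ := c / n * (k - 1) with hy
  have hx0 : 0 < x := by positivity
  have hβ0 : 0 < β := by positivity
  have hγ0 : 0 < γ := by rw [hγ]; positivity
  have hyx : y ≤ c * x := by
    rw [hy, hx, div_mul_eq_mul_div, mul_div_assoc']
    gcongr
    linarith
  have hy0 : 0 < y := mul_pos (by positivity) (by linarith)
  have hP := measureReal_isDenseClosed_le (by positivity) ((div_le_one hn).2 hcn) hk hy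
    (by nlinarith) S hS
  have hbase : Real.exp 1 * (k * y / 2) / (2 * k - 3) ≤ β * x := by
    rw [div_le_iff₀ (by linarith), hβ]
    calc Real.exp 1 * (k * y / 2) = Real.exp 1 / 2 * (y * k) := by ring
      _ ≤ Real.exp 1 / 2 * (c * x * (2 * k - 3)) := by
        gcongr
        linarith
      _ = _ := by ring
  have h1 : Real.exp (-(k * y / 2)) ≤ 1 := Real.exp_le_one_iff.2 (by
    have : 0 ≤ k * y / 2 := by positivity
    linarith)
  have h2 : ((1 + y) * Real.exp (-y)) ^ (n - k) ≤ 1 := by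
    refine pow_le_one₀ (by positivity) ?_
    rw [Real.exp_neg, ← div_eq_mul_inv, div_le_one (Real.exp_pos _)]
    linarith [Real.add_one_le_exp y]
  have hP' : (erdosRenyi n (c / n)).real {G | IsDenseClosed G S} ≤ (β * x) ^ (2 * k - 3) := by
    have h3 : 0 ≤ Real.exp 1 * (k * y / 2) / (2 * k - 3) := by
      have : (0 : ℝ) < 2 * k - 3 := by linarith
      positivity
    calc _ ≤ _ := hP
      _ ≤ (β * x) ^ (2 * k - 3) * 1 * 1 := by gcongr
      _ = _ := by ring
  have hC := choose_le_exp_mul_div_pow n (by omega : 0 < k)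
  have hxi : (n : ℝ) / k = x⁻¹ := by rw [hx, inv_div]
  rw [hxi] at hC
  refine (mul_le_mul hC hP' measureReal_nonneg (by positivity)).trans ?_
  obtain ⟨j, rfl⟩ : ∃ j, k = j + 4 := ⟨k - 4, by omega⟩
  have h4 : 2 * (j + 4) - 3 = 2 * j + 5 := by omega
  rw [h4]
  have h5 : (Real.exp 1 * x⁻¹) ^ (j + 4) * (β * x) ^ (2 * j + 5)
      = (Real.exp 1 * β) ^ 3 * (γ * x) ^ (j + 1) := by
    have h6 : (β * x) ^ (2 * j + 5) = β ^ (2 * j + 5) * x ^ (j + 4) * x ^ (j + 1) := by ring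
    rw [h6, mul_pow, inv_pow, hγ]
    field_simp
    ring_nf
  rw [h5, pow_succ (γ * x)]
  calc (Real.exp 1 * β) ^ 3 * ((γ * x) ^ j * (γ * x))
      ≤ (Real.exp 1 * β) ^ 3 * ((1 / 2) ^ j * (γ * x)) := by gcongr
    _ = _ := by rw [hx]; ring

theorem exponent_bound {x : ℝ} (h0 : 0 ≤ x) (h1 : x ≤ 1 / 10) :
    3.0005 + (10 * x - 33 / 10) - 2 * x - (1 - x) * (8 * x - 21.4 * x ^ 2) ≤ -(1 / 50) := by
  nlinarith [mul_nonneg h0 (sub_nonneg.2 h1), pow_nonneg h0 3]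

theorem choose_mul_measureReal_le_of_large {n k : ℕ} {c t : ℝ} (hc4 : 4 < c) (hc : c ≤ 4.001)
    (ht : 0 < t) (hk : 4 ≤ k) (htk : t * n ≤ k) (hkn : (k : ℝ) < n / 10)
    (hck : 4 * (k : ℝ) ≤ c * (k - 1)) (S : Finset (Fin n)) (hS : S.card = k) :
    n.choose k * (erdosRenyi n (c / n)).real {G | IsDenseClosed G S}
      ≤ Real.exp (-3 * Real.log t) * Real.exp (-(t * n / 50)) := by
  have hk' : (4 : ℝ) ≤ k := by exact_mod_cast hk
  have hn : (0 : ℝ) < n := by linarith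
  set x : ℝ := k / n with hx
  set y : ℝ := c / n * (k - 1) with hy
  have hx0 : 0 < x := by positivity
  have hx1 : x ≤ 1 / 10 := by rw [hx, div_le_iff₀ hn]; linarith
  have htx : t ≤ x := by rwa [hx, le_div_iff₀ hn]
  have hyx : y ≤ 4.001 * x := by
    rw [hy, hx, div_mul_eq_mul_div, mul_div_assoc']
    exact div_le_div_of_nonneg_right (by nlinarith) hn.le
  have hxy : 4 * x ≤ y := by
    rw [hy, hx, div_mul_eq_mul_div, mul_div_assoc']
    exact div_le_div_of_nonneg_right hck hn.le
  have hy0 : 0 < y := by linarith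
  have hm0 : (0 : ℝ) < 2 * k - 3 := by linarith
  have hcast : ((2 * k - 3 : ℕ) : ℝ) = 2 * k - 3 := by
    rw [Nat.cast_sub (by omega)]; push_cast; ring
  have hcn : c ≤ n := by linarith
  have hym : k * y / 2 ≤ 2 * k - 3 := by
    have : k * y ≤ k * 1 := by gcongr; linarith
    linarith
  have hP := measureReal_isDenseClosed_le (n := n) (p := c / n) (by positivity)
    ((div_le_one hn).2 hcn) hk hy hym S hS
  have hC := choose_le_exp_mul_div_pow n (by omega : 0 < k)
  set L := Real.log x with hL
  have hxe : x = Real.exp L := (Real.exp_log hx0).symm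
  have hLt : Real.log t ≤ L := Real.log_le_log ht htx
  have hL10 : L ≤ 10 * x - 33 / 10 := by
    have h1 := Real.log_le_sub_one_of_pos (by positivity : 0 < 10 * x)
    rw [Real.log_mul (by norm_num) hx0.ne'] at h1
    linarith [log_ten_gt]
  have hC' : (n.choose k : ℝ) ≤ Real.exp (k * (1 - L)) := by
    refine hC.trans_eq ?_
    have hxi : (n : ℝ) / k = x⁻¹ := by rw [hx, inv_div]
    rw [hxi, Real.exp_nat_mul, Real.exp_sub, ← hxe, div_eq_mul_inv]
  have hD : (Real.exp 1 * (k * y / 2) / (2 * k - 3)) ^ (2 * k - 3)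
      ≤ Real.exp (2 * k * (1 + L + 0.00025) - 3 * Real.log t) := by
    have hpos : 0 < Real.exp 1 * (k * y / 2) / (2 * k - 3) := by positivity
    have hsplit : Real.exp 1 * (k * y / 2) / (2 * k - 3)
        = Real.exp 1 * (y / 4) * (2 * k / (2 * k - 3)) := by
      field_simp
      ring
    have h1 : y / 4 ≤ Real.exp (L + 0.00025) := by
      rw [Real.exp_add, ← hxe]
      calc y / 4 ≤ x * 1.00025 := by linarith
        _ ≤ x * Real.exp 0.00025 := by
          gcongr
          linarith [Real.add_one_le_exp (0.00025 : ℝ)]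
    have h2 : 2 * k / (2 * k - 3) ≤ Real.exp (3 / (2 * k - 3)) := by
      refine le_trans (le_of_eq ?_) (Real.add_one_le_exp _)
      field_simp
      ring
    have h3 : Real.exp 1 * (k * y / 2) / (2 * k - 3)
        ≤ Real.exp (1 + (L + 0.00025) + 3 / (2 * k - 3)) := by
      rw [hsplit, Real.exp_add, Real.exp_add]
      have h20 : 0 ≤ 2 * (k : ℝ) / (2 * k - 3) := by positivity
      gcongr
    refine (pow_le_pow_left₀ hpos.le h3 _).trans ?_
    rw [← Real.exp_nat_mul, hcast, Real.exp_le_exp]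
    have h4 : (2 * (k : ℝ) - 3) * (3 / (2 * k - 3)) = 3 := by field_simp
    rw [mul_add, h4]
    linarith
  have hE : Real.exp (-(k * y / 2)) ≤ Real.exp (-(2 * k * x)) := by
    rw [Real.exp_le_exp]
    have : k * (4 * x) ≤ k * y := by gcongr
    linarith
  have hF : ((1 + y) * Real.exp (-y)) ^ (n - k)
      ≤ Real.exp (-(k * ((1 - x) * (8 * x - 21.4 * x ^ 2)))) := by
    have hy1 : y ≤ 1 := by linarith
    have h1 : (1 + y) * Real.exp (-y) ≤ Real.exp (-(8 * x ^ 2 - 21.4 * x ^ 3)) := by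
      refine (one_add_mul_exp_neg_le hy0.le hy1).trans ?_
      rw [Real.exp_le_exp]
      have h2 : (4 * x) ^ 2 ≤ y ^ 2 := by gcongr
      have h3 : y ^ 3 ≤ (4.001 * x) ^ 3 := by gcongr
      linarith [pow_pos hx0 3]
    refine (pow_le_pow_left₀ (by positivity) h1 _).trans_eq ?_
    have hkn' : k ≤ n := by
      have : (k : ℝ) ≤ n := by linarith
      exact_mod_cast this
    rw [← Real.exp_nat_mul, Nat.cast_sub hkn']
    congr 1
    have hkx : (k : ℝ) = x * n := by rw [hx]; field_simp
    rw [hkx]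
    ring
  calc n.choose k * (erdosRenyi n (c / n)).real {G | IsDenseClosed G S}
      ≤ Real.exp (k * (1 - L)) * (Real.exp (2 * k * (1 + L + 0.00025) - 3 * Real.log t) *
        Real.exp (-(2 * k * x)) * Real.exp (-(k * ((1 - x) * (8 * x - 21.4 * x ^ 2))))) := by
        refine mul_le_mul hC' (hP.trans ?_) measureReal_nonneg (Real.exp_pos _).le
        gcongr
    _ = Real.exp (-3 * Real.log t + k * (3.0005 + L - 2 * x
        - (1 - x) * (8 * x - 21.4 * x ^ 2))) := by
        rw [← Real.exp_add, ← Real.exp_add, ← Real.exp_add]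
        congr 1
        ring
    _ ≤ Real.exp (-3 * Real.log t + k * (-(1 / 50))) := by
        rw [Real.exp_le_exp]
        gcongr
        linarith [exponent_bound hx0.le hx1]
    _ ≤ _ := by
        rw [← Real.exp_add, Real.exp_le_exp]
        linarith

theorem exists_measureReal_small_le {c : ℝ} (hc : 0 < c) :
    ∃ t : ℝ, 0 < t ∧ ∃ D : ℝ, ∀ n : ℕ, c ≤ n →
      (erdosRenyi n (c / n)).real
        {G | ∃ S : Finset (Fin n), 4 ≤ S.card ∧ (S.card : ℝ) < t * n ∧ IsDenseClosed G S}
        ≤ D * (n : ℝ)⁻¹ := by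
  set γ : ℝ := Real.exp 1 * (Real.exp 1 * c / 2) ^ 2 with hγ
  have hγ0 : 0 < γ := by positivity
  set A : ℝ := (Real.exp 1 * (Real.exp 1 * c / 2)) ^ 3 * γ with hA
  have hA0 : 0 < A := by positivity
  refine ⟨min (1 / c) (1 / 2 / γ), by positivity, A * 32, fun n hcn => ?_⟩
  have hn : (0 : ℝ) < n := hc.trans_le hcn
  set t := min (1 / c) (1 / 2 / γ) with ht
  set K : Finset ℕ := (Finset.range (n + 1)).filter fun k => 4 ≤ k ∧ (k : ℝ) < t * n with hK
  have hsub : {G | ∃ S : Finset (Fin n), 4 ≤ S.card ∧ (S.card : ℝ) < t * n ∧ IsDenseClosed G S}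
      ⊆ {G | ∃ S : Finset (Fin n), S.card ∈ K ∧ IsDenseClosed G S} := by
    rintro G ⟨S, h4, htn, hS⟩
    have := S.card_le_univ
    rw [Fintype.card_fin] at this
    refine ⟨S, ?_, hS⟩
    simp only [hK, Finset.mem_filter, Finset.mem_range]
    exact ⟨by omega, h4, htn⟩
  have := isProbabilityMeasure_erdosRenyi n (div_nonneg hc.le hn.le) ((div_le_one hn).2 hcn)
  refine (measureReal_mono hsub).trans ((measureReal_exists_isDenseClosed_le K
    (fun k => A / n * (16 * (k * (1 / 2) ^ k))) (fun k _ => by positivity)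
    fun k hk S hS => ?_).trans ?_)
  · simp only [hK, Finset.mem_filter, Finset.mem_range] at hk
    obtain ⟨-, hk4, hkt⟩ := hk
    have hx : (k : ℝ) / n < t := by rwa [div_lt_iff₀ hn]
    have hx1 : (k : ℝ) / n ≤ 1 / c := hx.le.trans (min_le_left _ _)
    have hx2 : (k : ℝ) / n ≤ 1 / 2 / γ := hx.le.trans (min_le_right _ _)
    rw [le_div_iff₀' hc] at hx1
    rw [le_div_iff₀' hγ0] at hx2
    exact choose_mul_measureReal_le_of_small hc hcn hk4 hx1 hγ hx2 S hS
  · have hnorm : ‖(1 / 2 : ℝ)‖ < 1 := by norm_num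
    have hsum : HasSum (fun k : ℕ => (k : ℝ) * (1 / 2) ^ k) 2 := by
      have := hasSum_coe_mul_geometric_of_norm_lt_one hnorm
      norm_num at this ⊢
      exact this
    have hle : ∑ k ∈ K, (k : ℝ) * (1 / 2) ^ k ≤ 2 :=
      sum_le_hasSum K (fun k _ => by positivity) hsum
    rw [← Finset.mul_sum, ← Finset.mul_sum]
    calc A / n * (16 * ∑ k ∈ K, (k : ℝ) * (1 / 2) ^ k) ≤ A / n * (16 * 2) := by gcongr
      _ = _ := by ring

theorem eventually_measureReal_medium_le {c t : ℝ} (hc4 : 4 < c) (hc : c ≤ 4.001) (ht : 0 < t) :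
    ∀ᶠ n : ℕ in atTop, (erdosRenyi n (c / n)).real
      {G | ∃ S : Finset (Fin n), 4 ≤ S.card ∧ t * n ≤ S.card ∧ (S.card : ℝ) < n / 10 ∧
        IsDenseClosed G S}
      ≤ (n + 1) * (Real.exp (-3 * Real.log t) * Real.exp (-(t * n / 50))) := by
  have hlarge : ∀ᶠ n : ℕ in atTop, c / (c - 4) ≤ t * n :=
    (tendsto_natCast_atTop_atTop.const_mul_atTop ht).eventually_ge_atTop _
  filter_upwards [hlarge, tendsto_natCast_atTop_atTop.eventually_ge_atTop c] with n hn hcn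
  have hn0 : (0 : ℝ) < n := by linarith
  set K : Finset ℕ := (Finset.range (n + 1)).filter
    fun k => 4 ≤ k ∧ t * n ≤ k ∧ (k : ℝ) < n / 10 with hK
  have hsub : {G | ∃ S : Finset (Fin n), 4 ≤ S.card ∧ t * n ≤ S.card ∧
      (S.card : ℝ) < n / 10 ∧ IsDenseClosed G S}
      ⊆ {G | ∃ S : Finset (Fin n), S.card ∈ K ∧ IsDenseClosed G S} := by
    rintro G ⟨S, h4, htn, h10, hS⟩
    have := S.card_le_univ
    rw [Fintype.card_fin] at this
    refine ⟨S, ?_, hS⟩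
    simp only [hK, Finset.mem_filter, Finset.mem_range]
    exact ⟨by omega, h4, htn, h10⟩
  have := isProbabilityMeasure_erdosRenyi n (div_nonneg (by linarith) hn0.le)
    ((div_le_one hn0).2 hcn)
  refine (measureReal_mono hsub).trans ((measureReal_exists_isDenseClosed_le K
    (fun _ => Real.exp (-3 * Real.log t) * Real.exp (-(t * n / 50))) (fun k _ => by positivity)
    fun k hk S hS => ?_).trans ?_)
  · simp only [hK, Finset.mem_filter, Finset.mem_range] at hk
    obtain ⟨-, hk4, hkt, hk10⟩ := hk
    refine choose_mul_measureReal_le_of_large hc4 hc ht hk4 hkt hk10 ?_ S hS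
    have h1 := hn.trans hkt
    rw [div_le_iff₀ (by linarith)] at h1
    linarith
  · rw [Finset.sum_const, nsmul_eq_mul]
    have hcard : K.card ≤ n + 1 := by simpa using Finset.card_filter_le (Finset.range (n + 1)) _
    have hcard' : (K.card : ℝ) ≤ n + 1 := by exact_mod_cast hcard
    gcongr

theorem measureReal_ncard_edges_le {n : ℕ} {c δ : ℝ} (hcn : c ≤ n) (hδ0 : 0 < δ)
    (hδ1 : δ ≤ 1 / 2) (hcδ : c = 4 + 16 * δ) :
    (erdosRenyi n (c / n)).real {G | (spannedEdges G Finset.univ).ncard ≤ 2 * n}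
      ≤ Real.exp (-(4 * δ ^ 2 * n) + δ * c / 2) := by
  have hn : (0 : ℝ) < n := by linarith
  have hc0 : 0 < c := by linarith
  set p := c / n with hp
  have hp0 : 0 ≤ p := by positivity
  have hp1 : p ≤ 1 := (div_le_one hn).2 hcn
  have h1δ : 0 < 1 - δ := by linarith
  have key := mul_measureReal_pi_bernoulliMeasure_le (ι := VertexPair n) (p := p)
    (a := (1 - δ) ^ (2 * n))
    (A := graphOfMarks ⁻¹' {G | (spannedEdges G Finset.univ).ncard ≤ 2 * n}) hp0 hp1
    ({()} : Finset Unit) (fun _ _ b => if b = true then 1 - δ else 1)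
    (fun _ _ b => by split_ifs <;> linarith) (by
      intro f hf
      change (spannedEdges (graphOfMarks f) Finset.univ).ncard ≤ 2 * n at hf
      rw [ncard_spannedEdges_graphOfMarks] at hf
      have huniv : pairsIn (Finset.univ : Finset (Fin n)) = Finset.univ := by simp [pairsIn]
      rw [huniv] at hf
      rw [Finset.sum_singleton, Finset.prod_ite, Finset.prod_const_one, mul_one,
        Finset.prod_const]
      exact pow_le_pow_of_le_one h1δ.le (by linarith) hf)
  rw [← measureReal_erdosRenyi] at key
  have hcard : Fintype.card (VertexPair n) = n.choose 2 := by
    rw [Sym2.card_subtype_not_diag, Fintype.card_fin]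
  have hrhs : (p * (1 - δ) + (1 - p) * 1) ^ n.choose 2 ≤ Real.exp (-(δ * (c * (n - 1) / 2))) := by
    have h1 : p * (1 - δ) + (1 - p) * 1 ≤ Real.exp (-(δ * p)) := by
      have := Real.add_one_le_exp (-(δ * p)); linarith
    have h2 : 0 ≤ p * (1 - δ) + (1 - p) * 1 := by nlinarith
    refine (pow_le_pow_left₀ h2 h1 _).trans_eq ?_
    rw [← Real.exp_nat_mul, Nat.cast_choose_two, hp]
    congr 1
    field_simp
  have hlhs : Real.exp (-(2 * n * (δ + 2 * δ ^ 2))) ≤ (1 - δ) ^ (2 * n) := by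
    have h1 : Real.exp (-(δ + 2 * δ ^ 2)) ≤ 1 - δ := by
      rw [Real.exp_neg, inv_le_comm₀ (Real.exp_pos _) h1δ]
      refine le_trans ?_ (Real.add_one_le_exp _)
      rw [inv_le_iff_one_le_mul₀ h1δ]
      nlinarith [pow_pos hδ0 2]
    refine le_trans (le_of_eq ?_) (pow_le_pow_left₀ (Real.exp_pos _).le h1 _)
    rw [← Real.exp_nat_mul]
    congr 1
    push_cast
    ring
  simp only [Finset.sum_singleton, if_true, Bool.false_eq_true, if_false, Finset.prod_const,
    Finset.card_univ, hcard] at key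
  have h := (mul_le_mul_of_nonneg_right hlhs measureReal_nonneg).trans (key.trans hrhs)
  rw [← le_div_iff₀' (Real.exp_pos _), ← Real.exp_sub] at h
  refine h.trans_eq ?_
  congr 1
  rw [hcδ]
  ring

theorem tendsto_erdosRenyi_of_compl_le {c : ℝ} (hc : 0 ≤ c)
    {A : ∀ n : ℕ, Set (SimpleGraph (Fin n))} {u : ℕ → ℝ} (hu : Tendsto u atTop (nhds 0))
    (h : ∀ᶠ n : ℕ in atTop, (erdosRenyi n (c / n)).real (A n)ᶜ ≤ u n) :
    Tendsto (fun n : ℕ => erdosRenyi n (c / n) (A n)) atTop (nhds 1) := by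
  have hev : ∀ᶠ n : ℕ in atTop, ENNReal.ofReal (1 - u n) ≤ erdosRenyi n (c / n) (A n) ∧
      erdosRenyi n (c / n) (A n) ≤ 1 := by
    filter_upwards [h, tendsto_natCast_atTop_atTop.eventually_ge_atTop c] with n hn hcn
    have := isProbabilityMeasure_erdosRenyi n (div_nonneg hc n.cast_nonneg)
      (div_le_one_of_le₀ hcn n.cast_nonneg)
    refine ⟨?_, prob_le_one⟩
    rw [probReal_compl_eq_one_sub (Set.toFinite _).measurableSet] at hn
    exact ENNReal.ofReal_le_of_le_toReal (by change _ ≤ (erdosRenyi n (c / n)).real (A n); linarith)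
  have hl : Tendsto (fun n => ENNReal.ofReal (1 - u n)) atTop (nhds 1) := by
    simpa using ENNReal.tendsto_ofReal (hu.const_sub 1)
  exact tendsto_of_tendsto_of_tendsto_of_le_of_le' hl tendsto_const_nhds
    (hev.mono fun _ h => h.1) (hev.mono fun _ h => h.2)

theorem tendsto_giant_of_le {c : ℝ} (hc4 : 4 < c) (hc : c ≤ 4.001) :
    Tendsto (fun n : ℕ => erdosRenyi n (c / n)
      {G | ∃ S : Finset (Fin n), IsRigidComponent G S ∧ (n : ℝ) / 10 ≤ (S.card : ℝ)})
      atTop (nhds 1) := by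
  obtain ⟨t, ht, D, hD⟩ := exists_measureReal_small_le (by linarith : 0 < c)
  set δ := (c - 4) / 16 with hδ
  have hδ0 : 0 < δ := by rw [hδ]; linarith
  have hδ1 : δ ≤ 1 / 2 := by rw [hδ]; linarith
  refine tendsto_erdosRenyi_of_compl_le (by linarith) (u := fun n : ℕ => D * (n : ℝ)⁻¹ +
    (n + 1) * (Real.exp (-3 * Real.log t) * Real.exp (-(t * n / 50))) +
    Real.exp (-(4 * δ ^ 2 * n) + δ * c / 2)) ?_ ?_
  · have h1 : Tendsto (fun n : ℕ => D * (n : ℝ)⁻¹) atTop (nhds 0) := by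
      simpa using (tendsto_inv_atTop_nhds_zero_nat (𝕜 := ℝ)).const_mul D
    have h2 : Tendsto (fun n : ℕ => (n + 1 : ℝ) *
        (Real.exp (-3 * Real.log t) * Real.exp (-(t * n / 50)))) atTop (nhds 0) := by
      have hr : |Real.exp (-(t / 50))| < 1 := by
        rw [abs_of_pos (Real.exp_pos _), Real.exp_lt_one_iff]
        linarith
      have h3 := ((tendsto_pow_const_mul_const_pow_of_abs_lt_one 1 hr).add
        (tendsto_pow_const_mul_const_pow_of_abs_lt_one 0 hr)).const_mul
        (Real.exp (-3 * Real.log t))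
      simp only [add_zero, mul_zero] at h3
      refine h3.congr fun n => ?_
      have h4 : Real.exp (-(t * n / 50)) = Real.exp (-(t / 50)) ^ n := by
        rw [← Real.exp_nat_mul]; congr 1; ring
      rw [h4]
      ring
    have h3 : Tendsto (fun n : ℕ => Real.exp (-(4 * δ ^ 2 * n) + δ * c / 2)) atTop (nhds 0) := by
      refine Real.tendsto_exp_atBot.comp (tendsto_atBot_add_const_right _ _ ?_)
      exact tendsto_neg_atTop_atBot.comp
        (tendsto_natCast_atTop_atTop.const_mul_atTop (by positivity))
    simpa using (h1.add h2).add h3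
  · filter_upwards [eventually_measureReal_medium_le hc4 hc ht,
      tendsto_natCast_atTop_atTop.eventually_ge_atTop c, eventually_ge_atTop 2] with n hmed hcn hn2
    have := isProbabilityMeasure_erdosRenyi n (div_nonneg (by linarith) n.cast_nonneg)
      (div_le_one_of_le₀ hcn n.cast_nonneg)
    refine le_trans (measureReal_mono ?_) ((measureReal_union_le
      ({G | ∃ S : Finset (Fin n), 4 ≤ S.card ∧ (S.card : ℝ) < t * n ∧ IsDenseClosed G S} ∪
        {G | ∃ S : Finset (Fin n), 4 ≤ S.card ∧ t * n ≤ S.card ∧ (S.card : ℝ) < n / 10 ∧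
          IsDenseClosed G S})
      {G | (spannedEdges G Finset.univ).ncard ≤ 2 * n}).trans (add_le_add
        ((measureReal_union_le _ _).trans (add_le_add (hD n hcn) hmed))
        (measureReal_ncard_edges_le hcn hδ0 hδ1 (by rw [hδ]; ring))))
    intro G hG
    by_contra hbad
    simp only [Set.mem_union, Set.mem_ofPred_eq, not_or, not_exists, not_and, not_le] at hbad
    obtain ⟨⟨hsmall, hmedium⟩, hedges⟩ := hbad
    have hge : 2 * n - 2 ≤ (spannedEdges G Finset.univ).ncard := by omega
    obtain ⟨S, hS4, hS⟩ := exists_isRigidOn_of_le_ncard hn2 hge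
    obtain ⟨S', hSS', hS'⟩ := hS.exists_isRigidComponent (by omega)
    have hS'4 : 4 ≤ S'.card := hS4.trans (Finset.card_le_card hSS')
    refine hG ⟨S', hS', ?_⟩
    by_contra hlt
    rw [not_le] at hlt
    rcases lt_or_ge (S'.card : ℝ) (t * n) with h | h
    · exact hsmall S' hS'4 h hS'.isDenseClosed
    · exact hmedium S' hS'4 h hlt hS'.isDenseClosed

/-- Size and emergence of a large rigid component: for `c > 0`, almost surely all
rigid components of `G(n, c/n)` span 2, 3, or at least `t·n` vertices (for some
constant `t > 0` depending only on `c`); and if `c > 4`, almost surely there is a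
rigid component spanning at least `n/10` vertices. -/
theorem emergence (c : ℝ) (hc : 0 < c) :
    (∃ t : ℝ, 0 < t ∧
      Tendsto (fun n : ℕ =>
        erdosRenyi n (c / n)
          {G | ∀ S : Finset (Fin n), IsRigidComponent G S →
            S.card = 2 ∨ S.card = 3 ∨ t * n ≤ (S.card : ℝ)})
        atTop (nhds 1)) ∧
    (4 < c →
      Tendsto (fun n : ℕ =>
        erdosRenyi n (c / n)
          {G | ∃ S : Finset (Fin n), IsRigidComponent G S ∧ (n : ℝ) / 10 ≤ (S.card : ℝ)})
        atTop (nhds 1)) := by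
  constructor
  · obtain ⟨t, ht, D, hD⟩ := exists_measureReal_small_le hc
    refine ⟨t, ht, tendsto_erdosRenyi_of_compl_le hc.le (u := fun n : ℕ => D * (n : ℝ)⁻¹) ?_ ?_⟩
    · simpa using (tendsto_inv_atTop_nhds_zero_nat (𝕜 := ℝ)).const_mul D
    · filter_upwards [tendsto_natCast_atTop_atTop.eventually_ge_atTop c] with n hcn
      have := isProbabilityMeasure_erdosRenyi n (div_nonneg hc.le n.cast_nonneg)
        (div_le_one_of_le₀ hcn n.cast_nonneg)
      refine (measureReal_mono ?_).trans (hD n hcn)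
      intro G hG
      simp only [Set.mem_compl_iff, Set.mem_ofPred_eq, not_forall, not_or, not_le] at hG
      obtain ⟨S, hS, h2, h3, ht⟩ := hG
      have := hS.1
      exact ⟨S, by omega, ht, hS.isDenseClosed⟩
  · intro hc4
    have hmin : 4 < min c 4.001 := lt_min hc4 (by norm_num)
    refine tendsto_of_tendsto_of_tendsto_of_le_of_le'
      (tendsto_giant_of_le hmin (min_le_right _ _)) tendsto_const_nhds ?_ ?_
    · filter_upwards [tendsto_natCast_atTop_atTop.eventually_ge_atTop c] with n hcn
      refine erdosRenyi_mono (div_nonneg (by linarith) n.cast_nonneg)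
        (div_le_div_of_nonneg_right (min_le_left _ _) n.cast_nonneg)
        (div_le_one_of_le₀ hcn n.cast_nonneg) ?_
      rintro G ⟨S, hS, hSn⟩ H hGH
      obtain ⟨S', hSS', hS'⟩ := (hS.2.1.mono hGH).exists_isRigidComponent hS.1
      have hcard : (S.card : ℝ) ≤ S'.card := by exact_mod_cast Finset.card_le_card hSS'
      exact ⟨S', hS', hSn.trans hcard⟩
    · filter_upwards [tendsto_natCast_atTop_atTop.eventually_ge_atTop c] with n hcn
      have := isProbabilityMeasure_erdosRenyi n (div_nonneg hc.le n.cast_nonneg)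
        (div_le_one_of_le₀ hcn n.cast_nonneg)
      exact prob_le_one
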